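/- Let V be a nonempty open subset of ℝ^d and let m ≥ 1. Then there is no function F from finite multisets over V to ℝ^m that is simultaneously (i) continuous, in the sense that for every n the induced map (x_1, ..., x_n) ↦ F({x_1, ..., x_n}) on V^n is continuous, (ii) injective on finite multisets, and (iii) separating, i.e., F(S) ≤ F(T) coordinatewise implies S ⊆ T. -/

import Mathlib

open MeasureTheory Metric Set

/-- Evaluation at `1` of polynomials of bounded degree is a fixed linear combination of their
values at sufficiently many nodes. -/
theorem exists_extrapolation_weights (s : Finset ℝ) (n : ℕ) (hs : n < s.card) :
    ∃ w : ℝ → ℝ, ∀ p : Polynomial ℝ, p.natDegree ≤ n →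
      p.eval 1 = ∑ t ∈ s, w t * p.eval t := by
  refine ⟨fun t => (Lagrange.basis s id t).eval 1, fun p hp => ?_⟩
  have hdeg : p.degree < s.card :=
    (Polynomial.natDegree_le_iff_degree_le.1 hp).trans_lt (by exact_mod_cast hs)
  conv_lhs => rw [Lagrange.eq_interpolate (v := id) Function.injective_id.injOn hdeg]
  simp [Lagrange.interpolate_apply, Polynomial.eval_finsetSum, mul_comm]

section

variable {E : Type*} [NormedAddCommGroup E] [NormedSpace ℝ E] [FiniteDimensional ℝ E]

theorem exists_polynomial_det_one_add_smul (A : E →L[ℝ] E) :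
    ∃ p : Polynomial ℝ, p.natDegree ≤ Module.finrank ℝ E ∧
      ∀ t : ℝ, p.eval t = (1 + t • A).det := by
  let b := Module.finBasis ℝ E
  let M := LinearMap.toMatrix b b A
  refine ⟨_, by simpa using Polynomial.natDegree_det_X_add_C_le M 1, fun t => ?_⟩
  have h : (1 + t • A).det = (1 + t • M).det := by
    rw [ContinuousLinearMap.det, ← LinearMap.det_toMatrix b]
    simp [M, LinearMap.toMatrix_one]
  rw [h, ← Polynomial.coe_evalRingHom, RingHom.map_det]
  congr 1
  ext i j
  simp [Matrix.one_apply, add_comm, apply_ite, mul_comm t]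

theorem det_one_add_pos {A : E →L[ℝ] E} (hA : ‖A‖ < 1) : 0 < (1 + A).det := by
  have hne : ∀ t ∈ Icc (0 : ℝ) 1, (1 + t • A).det ≠ 0 := by
    intro t ht
    have hlt : ‖-(t • A)‖ < 1 := by
      rw [norm_neg, norm_smul, Real.norm_of_nonneg ht.1]
      nlinarith [norm_nonneg A, ht.2]
    have hu : IsUnit (1 + t • A) := by
      simpa using isUnit_one_sub_of_norm_lt_one hlt
    have hmap := (hu.map (ContinuousLinearMap.toLinearMapRingHom :
      (E →L[ℝ] E) →+* (E →ₗ[ℝ] E))).map (LinearMap.det : (E →ₗ[ℝ] E) →* ℝ)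
    exact hmap.ne_zero
  by_contra hneg
  have hc : ContinuousOn (fun t : ℝ => (1 + t • A).det) (Icc 0 1) := by
    exact (ContinuousLinearMap.continuous_det.comp
      (by fun_prop : Continuous fun t : ℝ => 1 + t • A)).continuousOn
  have h0 : (0 : ℝ) ∈ Icc ((1 + (1 : ℝ) • A).det) ((1 + (0 : ℝ) • A).det) := by
    constructor
    · simpa using hneg
    · simp [ContinuousLinearMap.det]
  obtain ⟨t, ht, h⟩ := intermediate_value_Icc' zero_le_one hc h0
  exact hne t ht h

/-- A small Lipschitz perturbation of the identity that is trivial outside a ball maps the ball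
bijectively onto itself, so its Jacobian determinant integrates to the volume of the ball. -/
theorem integral_det_one_add_smul_fderiv [MeasurableSpace E] [BorelSpace E] (μ : Measure E)
    [μ.IsAddHaarMeasure] {u : E → E} {K : NNReal} {R t : ℝ}
    (hu : LipschitzWith K u) (hu0 : ∀ x, R ≤ ‖x‖ → u x = 0)
    (hd : ∀ x ∈ ball (0 : E) R, DifferentiableAt ℝ u x) (ht0 : 0 ≤ t) (ht : t * K < 1) :
    IntegrableOn (fun x => (1 + t • fderiv ℝ u x).det) (ball 0 R) μ ∧
    ∫ x in ball 0 R, (1 + t • fderiv ℝ u x).det ∂μ = μ.real (ball 0 R) := by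
  set g : E → E := fun x => x + t • u x with hg
  have happ : ApproximatesLinearOn g ((ContinuousLinearEquiv.refl ℝ E : E ≃L[ℝ] E) : E →L[ℝ] E)
      univ (t.toNNReal * K) := by
    intro x _ y _
    have : g x - g y - ((ContinuousLinearEquiv.refl ℝ E : E ≃L[ℝ] E) : E →L[ℝ] E) (x - y)
        = t • (u x - u y) := by
      simp [hg, smul_sub]; abel
    rw [this, norm_smul, Real.norm_of_nonneg ht0]
    have := hu.dist_le_mul x y
    rw [dist_eq_norm, dist_eq_norm] at this
    calc t * ‖u x - u y‖ ≤ t * (K * ‖x - y‖) := by gcongr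
      _ = _ := by rw [NNReal.coe_mul, Real.coe_toNNReal t ht0, mul_assoc]
  have hc : Subsingleton E ∨ (t.toNNReal * K : NNReal) <
      ‖(((ContinuousLinearEquiv.refl ℝ E : E ≃L[ℝ] E).symm : E ≃L[ℝ] E) : E →L[ℝ] E)‖₊⁻¹ := by
    rcases subsingleton_or_nontrivial E with h | h
    · exact Or.inl h
    · right
      have : ‖(((ContinuousLinearEquiv.refl ℝ E : E ≃L[ℝ] E).symm : E ≃L[ℝ] E) : E →L[ℝ] E)‖₊
          = 1 := by
        ext; exact ContinuousLinearMap.norm_id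
      rw [this, inv_one, ← NNReal.coe_lt_coe, NNReal.coe_mul, Real.coe_toNNReal t ht0]
      exact ht
  have hinj : Function.Injective g := injOn_univ.1 (happ.injOn hc)
  have hsurj : Function.Surjective g := happ.surjective hc
  have hout : ∀ x, R ≤ ‖x‖ → g x = x := fun x hx => by simp [hg, hu0 x hx]
  have himg : g '' ball 0 R = ball 0 R := by
    ext y
    simp only [mem_image, mem_ball_zero_iff]
    constructor
    · rintro ⟨x, hx, rfl⟩
      by_contra h
      have := hinj (hout _ (not_lt.1 h))
      rw [this] at h
      exact h hx
    · intro hy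
      obtain ⟨x, rfl⟩ := hsurj y
      refine ⟨x, ?_, rfl⟩
      by_contra h
      rw [hout x (not_lt.1 h)] at hy
      exact h hy
  have hder : ∀ x ∈ ball (0 : E) R,
      HasFDerivWithinAt g (1 + t • fderiv ℝ u x) (ball 0 R) x := fun x hx =>
    ((hasFDerivAt_id x).add ((hd x hx).hasFDerivAt.const_smul t)).hasFDerivWithinAt
  have habs : ∀ x, |(1 + t • fderiv ℝ u x).det| = (1 + t • fderiv ℝ u x).det := by
    intro x
    refine abs_of_pos (det_one_add_pos ?_)
    rw [norm_smul, Real.norm_of_nonneg ht0]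
    have := norm_fderiv_le_of_lipschitz ℝ hu (x₀ := x)
    exact (mul_le_mul_of_nonneg_left this ht0).trans_lt ht
  have hi := integrableOn_image_iff_integrableOn_abs_det_fderiv_smul μ measurableSet_ball hder
    hinj.injOn (fun _ => (1 : ℝ))
  have he := integral_image_eq_integral_abs_det_fderiv_smul μ measurableSet_ball hder
    hinj.injOn (fun _ => (1 : ℝ))
  simp only [himg, habs, smul_eq_mul, mul_one] at hi he
  refine ⟨hi.1 (by simp [integrableOn_const_iff, measure_ball_lt_top]), ?_⟩
  rw [← he]
  simp

/-- A Lipschitz map that is the identity outside a ball and differentiable inside it does not have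
identically vanishing Jacobian determinant on the ball. -/
theorem exists_det_one_add_fderiv_ne_zero {u : E → E} {K : NNReal} {R : ℝ} (hR : 0 < R)
    (hu : LipschitzWith K u) (hu0 : ∀ x, R ≤ ‖x‖ → u x = 0)
    (hd : ∀ x ∈ ball (0 : E) R, DifferentiableAt ℝ u x) :
    ∃ x ∈ ball (0 : E) R, (1 + fderiv ℝ u x).det ≠ 0 := by
  borelize E
  let μ : Measure E := Measure.addHaar
  by_contra! h0
  have hinf : (Ioo (0 : ℝ) (1 / (K + 1))).Infinite := Ioo_infinite (by positivity)
  obtain ⟨s, hs, hcard⟩ := hinf.exists_subset_card_eq (Module.finrank ℝ E + 1)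
  obtain ⟨w, hw⟩ := exists_extrapolation_weights s (Module.finrank ℝ E) (by omega)
  have hint : ∀ t ∈ s, IntegrableOn (fun x => (1 + t • fderiv ℝ u x).det) (ball 0 R) μ ∧
      ∫ x in ball 0 R, (1 + t • fderiv ℝ u x).det ∂μ = μ.real (ball 0 R) := by
    intro t ht
    have ht' := hs ht
    refine integral_det_one_add_smul_fderiv μ hu hu0 hd ht'.1.le ?_
    have h1 : t * (K + 1) < 1 := (lt_div_iff₀ (by positivity)).1 ht'.2
    linarith [ht'.1]
  have hpt : ∀ x ∈ ball (0 : E) R, 0 = ∑ t ∈ s, w t * (1 + t • fderiv ℝ u x).det := by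
    intro x hx
    obtain ⟨p, hp, hpe⟩ := exists_polynomial_det_one_add_smul (fderiv ℝ u x)
    have := hw p hp
    simp only [hpe, one_smul, h0 x hx] at this
    exact this
  have hone : (1 : ℝ) = ∑ t ∈ s, w t := by simpa using hw 1 (by simp)
  have hz : ∫ x in ball 0 R, ∑ t ∈ s, w t * (1 + t • fderiv ℝ u x).det ∂μ = 0 := by
    rw [← setIntegral_congr_fun measurableSet_ball hpt]
    simp
  rw [integral_finsetSum _ fun t ht => (hint t ht).1.const_mul _] at hz
  simp_rw [integral_const_mul] at hz
  rw [Finset.sum_congr rfl fun t ht => by rw [(hint t ht).2], ← Finset.sum_mul, ← hone,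
    one_mul] at hz
  exact (ENNReal.toReal_pos (measure_ball_pos μ 0 hR).ne' measure_ball_lt_top.ne).ne' hz

end

section

variable {E : Type*} [NormedAddCommGroup E] [InnerProductSpace ℝ E]

theorem norm_radial_push_sub_le {R δ : ℝ} (hR : 0 ≤ R) (hδ : 0 < δ) {z w : E}
    (hz : δ ≤ ‖z‖) (hw : δ ≤ ‖w‖) :
    ‖(max (R - ‖z‖) 0 * ‖z‖⁻¹) • z - (max (R - ‖w‖) 0 * ‖w‖⁻¹) • w‖
      ≤ (1 + 2 * R / δ) * ‖z - w‖ := by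
  have hz0 : 0 < ‖z‖ := hδ.trans_le hz
  have hw0 : 0 < ‖w‖ := hδ.trans_le hw
  have hnorm : |‖w‖ - ‖z‖| ≤ ‖z - w‖ := by
    rw [norm_sub_rev]; exact abs_norm_sub_norm_le w z
  have hinv : ‖z‖⁻¹ ≤ δ⁻¹ := inv_anti₀ hδ hz
  have hdir : ‖‖z‖⁻¹ • z - ‖w‖⁻¹ • w‖ ≤ 2 / δ * ‖z - w‖ := by
    have h : ‖z‖⁻¹ • z - ‖w‖⁻¹ • w = ‖z‖⁻¹ • (z - w) + (‖z‖⁻¹ - ‖w‖⁻¹) • w := by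
      module
    have h2 : ‖(‖z‖⁻¹ - ‖w‖⁻¹) • w‖ = ‖z‖⁻¹ * |‖w‖ - ‖z‖| := by
      rw [norm_smul, Real.norm_eq_abs, inv_sub_inv hz0.ne' hw0.ne', abs_div, abs_mul,
        abs_norm, abs_norm]
      field_simp
    rw [h]
    calc _ ≤ ‖z‖⁻¹ * ‖z - w‖ + ‖z‖⁻¹ * |‖w‖ - ‖z‖| := by
          refine (norm_add_le _ _).trans_eq ?_
          rw [h2, norm_smul, norm_inv, norm_norm]
      _ ≤ δ⁻¹ * ‖z - w‖ + δ⁻¹ * ‖z - w‖ := by gcongr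
      _ = _ := by ring
  have hq : |max (R - ‖z‖) 0 - max (R - ‖w‖) 0| ≤ ‖z - w‖ := by
    refine (abs_max_sub_max_le_abs _ _ _).trans ?_
    rwa [sub_sub_sub_cancel_left]
  have hqw : |max (R - ‖w‖) 0| ≤ R := by
    rw [abs_of_nonneg (le_max_right _ _)]
    exact max_le (by linarith) hR
  have h : (max (R - ‖z‖) 0 * ‖z‖⁻¹) • z - (max (R - ‖w‖) 0 * ‖w‖⁻¹) • w =
      (max (R - ‖z‖) 0 - max (R - ‖w‖) 0) • (‖z‖⁻¹ • z) +
        max (R - ‖w‖) 0 • (‖z‖⁻¹ • z - ‖w‖⁻¹ • w) := by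
    module
  rw [h]
  calc _ ≤ |max (R - ‖z‖) 0 - max (R - ‖w‖) 0| * 1 +
        |max (R - ‖w‖) 0| * ‖‖z‖⁻¹ • z - ‖w‖⁻¹ • w‖ := by
        refine (norm_add_le _ _).trans_eq ?_
        rw [norm_smul, norm_smul, norm_smul, norm_inv, norm_norm, inv_mul_cancel₀ hz0.ne']
        rfl
    _ ≤ ‖z - w‖ * 1 + R * (2 / δ * ‖z - w‖) := by gcongr
    _ = _ := by ring

theorem det_eq_zero_of_norm_eventually_const [FiniteDimensional ℝ E] {G : E → E} {G' : E →L[ℝ] E} {x : E} {R : ℝ}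
    (hR : R ≠ 0) (hG : HasFDerivAt G G' x) (hn : ∀ᶠ y in nhds x, ‖G y‖ = R) :
    G'.det = 0 := by
  by_contra hdet
  have hin := hG.inner ℝ hG
  have hconst : (fun y => inner ℝ (G y) (G y)) =ᶠ[nhds x] fun _ => R ^ 2 := by
    filter_upwards [hn] with y hy
    rw [real_inner_self_eq_norm_sq, hy]
  have h0 := hin.unique ((hasFDerivAt_const (R ^ 2) x).congr_of_eventuallyEq hconst)
  let e := G'.toContinuousLinearEquivOfDetNeZero hdet
  have hv : G' (e.symm (G x)) = G x := e.apply_symm_apply (G x)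
  have := congr($h0 (e.symm (G x)))
  simp [hv, hn.self_of_nhds, hR] at this

variable [FiniteDimensional ℝ E]

/-- A `C¹` map that is the identity outside a ball attains `0`: otherwise pushing its values
radially to a large sphere would give a retraction of a ball onto its boundary. -/
theorem ContDiff.zero_mem_range_of_eq_self_outside {φ : E → E} {r : ℝ} (hr : 0 < r)
    (hφ : ContDiff ℝ 1 φ) (hout : ∀ x, r ≤ ‖x‖ → φ x = x) : 0 ∈ range φ := by
  by_contra hzero
  have hne : ∀ x, φ x ≠ 0 := fun x hx => hzero ⟨x, hx⟩
  obtain ⟨C, hC⟩ := (isCompact_closedBall (0 : E) r).exists_bound_of_continuousOn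
    hφ.continuous.continuousOn
  set R := max r C
  have hrR : r ≤ R := le_max_left _ _
  have hR : 0 < R := hr.trans_le hrR
  have hle : ∀ x ∈ ball (0 : E) R, ‖φ x‖ ≤ R := by
    intro x hx
    rcases le_total r ‖x‖ with h | h
    · rw [hout x h]; exact (mem_ball_zero_iff.1 hx).le
    · exact (hC x (mem_closedBall_zero_iff.2 h)).trans (le_max_right _ _)
  obtain ⟨x₀, -, hx₀⟩ := (isCompact_closedBall (0 : E) r).exists_isMinOn
    ⟨0, mem_closedBall_self hr.le⟩ hφ.continuous.norm.continuousOn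
  obtain ⟨δ, hδ, hδle⟩ : ∃ δ > 0, ∀ x, δ ≤ ‖φ x‖ := by
    refine ⟨min ‖φ x₀‖ r, lt_min (norm_pos_iff.2 (hne _)) hr, fun x => ?_⟩
    rcases le_total r ‖x‖ with h | h
    · rw [hout x h]; exact (min_le_right _ _).trans h
    · exact (min_le_left _ _).trans (hx₀ (mem_closedBall_zero_iff.2 h))
  have hsupp : HasCompactSupport fun x => φ x - x := by
    refine HasCompactSupport.intro (isCompact_closedBall (0 : E) r) fun x hx => ?_
    rw [mem_closedBall_zero_iff, not_le] at hx
    rw [hout x hx.le, sub_self]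
  obtain ⟨K, hK⟩ := ContDiff.lipschitzWith_of_hasCompactSupport (𝕂 := ℝ) hsupp
    (hφ.sub contDiff_id) one_ne_zero
  have hKφ : LipschitzWith (K + 1) φ := by
    simpa using hK.add LipschitzWith.id
  let p : E → E := fun x => (max (R - ‖φ x‖) 0 * ‖φ x‖⁻¹) • φ x
  have hp : LipschitzWith (Real.toNNReal (1 + 2 * R / δ) * (K + 1)) p := by
    refine LipschitzWith.of_dist_le_mul fun x y => ?_
    rw [dist_eq_norm, NNReal.coe_mul, Real.coe_toNNReal _ (by positivity), mul_assoc]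
    refine (norm_radial_push_sub_le hR.le hδ (hδle x) (hδle y)).trans ?_
    gcongr
    rw [← dist_eq_norm]
    exact hKφ.dist_le_mul x y
  let G : E → E := fun x => (R * ‖φ x‖⁻¹) • φ x
  have hGn : ∀ x, ‖G x‖ = R := fun x => by
    have := norm_pos_iff.2 (hne x)
    simp only [G]
    rw [norm_smul, norm_mul, norm_inv, norm_norm, mul_assoc, inv_mul_cancel₀ this.ne', mul_one,
      Real.norm_of_nonneg hR.le]
  have hGd : Differentiable ℝ G := fun x => by
    have hd := hφ.differentiable one_ne_zero x
    exact (((hd.norm ℝ (hne x)).inv (norm_ne_zero_iff.2 (hne x))).const_mul R).smul hd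
  have huG : ∀ x ∈ ball (0 : E) R, φ x - x + p x = G x - x := by
    intro x hx
    have hpos := norm_pos_iff.2 (hne x)
    simp only [p, G]
    rw [max_eq_left (sub_nonneg.2 (hle x hx)), sub_mul, mul_inv_cancel₀ hpos.ne']
    module
  have hev : ∀ x ∈ ball (0 : E) R, (fun y => φ y - y + p y) =ᶠ[nhds x] fun y => G y - y :=
    fun x hx => Filter.eventuallyEq_of_mem (isOpen_ball.mem_nhds hx) huG
  obtain ⟨x, hx, hdet⟩ := exists_det_one_add_fderiv_ne_zero hR (hK.add hp)
    (fun x hx => by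
      rw [hout x (hrR.trans hx), sub_self, zero_add]
      simp only [p]
      rw [hout x (hrR.trans hx), max_eq_right (sub_nonpos.2 hx), zero_mul, zero_smul])
    (fun x hx => ((hGd x).sub differentiableAt_id).congr_of_eventuallyEq (hev x hx))
  refine hdet (det_eq_zero_of_norm_eventually_const (x := x) hR.ne' ?_
    (Filter.Eventually.of_forall hGn))
  rw [(hev x hx).fderiv_eq]
  convert (hGd x).hasFDerivAt using 1
  rw [fderiv_fun_sub (hGd x) differentiableAt_fun_id, fderiv_fun_id]
  exact add_sub_cancel _ _

theorem ContDiff.surjective_of_eq_self_outside {φ : E → E} {r : ℝ} (hr : 0 < r)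
    (hφ : ContDiff ℝ 1 φ) (hout : ∀ x, r ≤ ‖x‖ → φ x = x) : Function.Surjective φ := by
  intro y
  obtain ⟨x, hx⟩ := ContDiff.zero_mem_range_of_eq_self_outside (φ := fun x => φ (x + y) - y)
    (r := r + ‖y‖) (by positivity) (by fun_prop) (fun x hx => by
      have : r ≤ ‖x + y‖ := by
        have := norm_sub_le (x + y) y
        rw [add_sub_cancel_right] at this
        linarith
      simp [hout _ this])
  exact ⟨x + y, sub_eq_zero.1 hx⟩

/-- Invariance of dimension: no continuous map from a closed ball to a space of smaller dimension
is injective. -/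
theorem not_injOn_closedBall_of_finrank_lt {F : Type*} [NormedAddCommGroup F] [NormedSpace ℝ F]
    [FiniteDimensional ℝ F] (hlt : Module.finrank ℝ F < Module.finrank ℝ E) {R : ℝ} (hR : 0 < R)
    {f : E → F} (hf : ContinuousOn f (closedBall 0 R)) : ¬ InjOn f (closedBall 0 R) := by
  intro hinj
  have : CompactSpace (closedBall (0 : E) R) :=
    isCompact_iff_compactSpace.1 (isCompact_closedBall _ _)
  have hemb : Topology.IsClosedEmbedding ((closedBall (0 : E) R).domRestrict f) :=
    hf.domRestrict.isClosedEmbedding (injOn_iff_injective.1 hinj)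
  obtain ⟨g, hg⟩ := ContinuousMap.exists_extension' hemb ⟨Subtype.val, continuous_subtype_val⟩
  obtain ⟨f₀, hf₀⟩ := ContinuousMap.exists_restrict_eq (isClosed_closedBall)
    (⟨_, hf.domRestrict⟩ : C(closedBall (0 : E) R, F))
  have hgf : ∀ x ∈ closedBall (0 : E) R, g (f₀ x) = x := by
    intro x hx
    have h1 := congr_fun hg ⟨x, hx⟩
    have h2 := congr($hf₀ ⟨x, hx⟩)
    simp at h1 h2
    rw [h2, h1]
  obtain ⟨g₁, hg₁, hgg, -⟩ := g.continuous.exists_contDiff_approx 1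
    (continuous_const (y := R / 8)) (fun _ => by positivity)
  obtain ⟨f₁, hf₁, hff⟩ : ∃ f₁ : E → F, ContDiff ℝ 1 f₁ ∧
      ∀ x ∈ closedBall (0 : E) R, dist (g₁ (f₁ x)) (g₁ (f₀ x)) < R / 8 := by
    obtain ⟨δ, hδ, hδ'⟩ : ∃ δ > 0, ∀ z ∈ f₀ '' closedBall (0 : E) R, ∀ w, dist w z < δ →
        dist (g₁ w) (g₁ z) < R / 8 := by
      have hc := ((isCompact_closedBall (0 : E) R).image f₀.continuous)
      have := hc.uniformContinuousAt_of_continuousAt g₁ (fun z _ => hg₁.continuous.continuousAt)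
        (dist_mem_uniformity (show 0 < R / 8 by positivity))
      obtain ⟨δ, hδ, h⟩ := mem_uniformity_dist.1 this
      refine ⟨δ, hδ, fun z hz w hw => ?_⟩
      rw [dist_comm]
      exact h (by rwa [dist_comm] at hw) hz
    obtain ⟨f₁, hf₁, hf₁', -⟩ := f₀.continuous.exists_contDiff_approx 1
      (continuous_const (y := δ)) (fun _ => hδ)
    exact ⟨f₁, hf₁, fun x hx => hδ' _ (mem_image_of_mem _ hx) _ (hf₁' x)⟩
  have hnear : ∀ x ∈ closedBall (0 : E) R, ‖g₁ (f₁ x) - x‖ ≤ R / 4 := by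
    intro x hx
    rw [← dist_eq_norm]
    have h1 := hff x hx
    have h2 := hgg (f₀ x)
    rw [hgf x hx] at h2
    linarith [dist_triangle (g₁ (f₁ x)) (g₁ (f₀ x)) x]
  let χ : ContDiffBump (0 : E) := ⟨R / 2, R, by positivity, by linarith⟩
  let φ : E → E := fun x => x + χ x • (g₁ (f₁ x) - x)
  have hφ : ContDiff ℝ 1 φ :=
    contDiff_id.add (χ.contDiff.smul ((hg₁.comp hf₁).sub contDiff_id))
  have hφout : ∀ x, R ≤ ‖x‖ → φ x = x := by
    intro x hx
    have : χ x = 0 := χ.zero_of_le_dist (by simpa using hx)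
    simp [φ, this]
  have hsurj := hφ.surjective_of_eq_self_outside hR hφout
  have hsub : ball (0 : E) (R / 4) ⊆ range g₁ := by
    intro y hy
    rw [mem_ball_zero_iff] at hy
    obtain ⟨x, rfl⟩ := hsurj y
    have hxR : ‖x‖ ≤ R := by
      by_contra! h
      rw [hφout x h.le] at hy
      linarith
    have hφx : ‖φ x - x‖ ≤ R / 4 := by
      simp only [φ, add_sub_cancel_left]
      rw [norm_smul, Real.norm_of_nonneg χ.nonneg]
      have := hnear x (mem_closedBall_zero_iff.2 hxR)
      nlinarith [χ.le_one (x := x), χ.nonneg (x := x), norm_nonneg (g₁ (f₁ x) - x)]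
    have hx2 : ‖x‖ ≤ R / 2 := by
      have := norm_sub_norm_le x (φ x)
      rw [norm_sub_rev] at this
      linarith
    have : χ x = 1 := χ.one_of_mem_closedBall (mem_closedBall_zero_iff.2 hx2)
    exact ⟨f₁ x, by simp [φ, this]⟩
  obtain ⟨y, hy, hyr⟩ := (hg₁.dense_compl_range_of_finrank_lt_finrank hlt).exists_mem_open
    isOpen_ball ⟨0, mem_ball_self (show 0 < R / 4 by positivity)⟩
  exact hy (hsub hyr)

end

/-- For a nonempty open set `V ⊆ ℝ^d` (`d ≥ 1`) and `m ≥ 1`, there is no function `F`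
from finite multisets over `V` to `ℝ^m` that is simultaneously continuous (in the sense
that each induced map on `V^n` is continuous), injective, and separating
(`F(S) ≤ F(T)` coordinatewise implies `S ⊆ T`). -/
theorem stmt15 (d : ℕ) (hd : 1 ≤ d) (V : Set (Fin d → ℝ)) (hVopen : IsOpen V)
    (hVne : V.Nonempty) (m : ℕ) (hm : 1 ≤ m) :
    ¬ ∃ F : Multiset V → Fin m → ℝ,
      (∀ n : ℕ, Continuous fun x : Fin n → V => F ↑(List.ofFn x)) ∧
      Function.Injective F ∧
      (∀ S T : Multiset V, F S ≤ F T → S ≤ T) := by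
  rintro ⟨F, hcont, hinj, -⟩
  obtain ⟨p, hp⟩ := hVne
  obtain ⟨r, hr, hrV⟩ := Metric.isOpen_iff.1 hVopen p hp
  have : NeZero d := ⟨by omega⟩
  set n := m + 1
  let s : EuclideanSpace ℝ (Fin n) → Fin n → ℝ := fun x i => r * ((3 * i + x i) / (4 * n))
  have hcoord : ∀ x ∈ closedBall (0 : EuclideanSpace ℝ (Fin n)) 1, ∀ i, |x i| ≤ 1 := by
    intro x hx i
    exact (PiLp.norm_apply_le x i).trans (mem_closedBall_zero_iff.1 hx)
  have hmem : ∀ x : closedBall (0 : EuclideanSpace ℝ (Fin n)) 1, ∀ i,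
      p + Pi.single 0 (s x i) ∈ V := by
    intro x i
    apply hrV
    rw [mem_ball, dist_eq_norm, add_sub_cancel_left, Pi.norm_single, Real.norm_eq_abs, abs_mul,
      abs_of_pos hr]
    have hn : (0 : ℝ) < 4 * n := by positivity
    have hi : (i : ℝ) + 1 ≤ n := by exact_mod_cast i.2
    have := abs_le.1 (hcoord x x.2 i)
    have hlt : |(3 * (i : ℝ) + x.1 i) / (4 * n)| < 1 := by
      rw [abs_div, abs_of_pos hn, div_lt_one hn, abs_lt]
      constructor <;> nlinarith [(Nat.cast_nonneg i.1 : (0 : ℝ) ≤ i.1)]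
    nlinarith
  let c : closedBall (0 : EuclideanSpace ℝ (Fin n)) 1 → Fin n → V :=
    fun x i => ⟨p + Pi.single 0 (s x i), hmem x i⟩
  have hc : Continuous c := by
    refine continuous_pi fun i => Continuous.subtype_mk ?_ _
    refine continuous_const.add ((continuous_single 0).comp ?_)
    simp only [s]
    fun_prop
  have hFc : Continuous fun x => F ↑(List.ofFn (c x)) := (hcont n).comp hc
  have hcinj : Function.Injective fun x => F ↑(List.ofFn (c x)) := by
    intro x y hxy
    have hperm := hinj hxy
    ext i
    have hi : c x i ∈ ((List.ofFn (c y) : List V) : Multiset V) := by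
      rw [← hperm, Multiset.mem_coe, List.mem_ofFn]
      exact ⟨i, rfl⟩
    obtain ⟨j, hj⟩ : ∃ j, c y j = c x i := by
      rwa [Multiset.mem_coe, List.mem_ofFn] at hi
    have hs : s y j = s x i := by
      simpa [c] using hj
    have hn : (4 * n : ℝ) ≠ 0 := by positivity
    have heq : 3 * (j : ℝ) + y.1 j = 3 * i + x.1 i := by
      have := mul_left_cancel₀ hr.ne' hs
      exact (div_left_inj' hn).1 this
    have hx := abs_le.1 (hcoord x x.2 i)
    have hy := abs_le.1 (hcoord y y.2 j)
    have hij : j = i := by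
      apply Fin.ext
      have h1 : (j : ℝ) < i + 1 := by linarith
      have h2 : (i : ℝ) < j + 1 := by linarith
      have h1' : (j : ℕ) < i + 1 := by exact_mod_cast h1
      have h2' : (i : ℕ) < j + 1 := by exact_mod_cast h2
      omega
    subst hij
    linarith
  obtain ⟨f, hf⟩ := ContinuousMap.exists_restrict_eq isClosed_closedBall
    (⟨_, hFc⟩ : C(closedBall (0 : EuclideanSpace ℝ (Fin n)) 1, Fin m → ℝ))
  refine not_injOn_closedBall_of_finrank_lt (by simp [n]) one_pos f.continuous.continuousOn ?_
  rw [injOn_iff_injective]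
  convert hcinj using 1
  ext x
  exact congr($hf x _)
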